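/- Let q be a prime power with q ≡ 1 (mod 4), set t = (q−1)/4, let T be a generator of the group of multiplicative characters of F_q^×, and let λ ∈ F_q with λ⁴ ∉ {0, 1}. Then Σ_{j=0}^{q−2} g(T^j)·g(T^{2t+j})·g(T^{t−j})·g(T^{3t−j})·T^{4j}(λ) = q(q−1)·g(T^{3t})² · ₂F₁(T^{3t}, T^t; T^{2t} | λ⁴)_q. -/

import Mathlib

/-- The standard additive character of a finite field `F` of characteristic `p`,
built from a primitive `p`-th root of unity `ζ` in `ℂ`:  `θ x = ζ ^ tr(x)`. -/
noncomputable def stdAddChar {F : Type*} [Field F] [Fintype F] (p : ℕ) [CharP F p]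
    [Algebra (ZMod p) F] (ζ : ℂ) (x : F) : ℂ :=
  ζ ^ (Algebra.trace (ZMod p) F x).val

/-- The Gauss sum `g(χ) = ∑ₓ χ(x) θ(x)` with respect to the standard additive character. -/
noncomputable def gaussSum' {F : Type*} [Field F] [Fintype F] (p : ℕ) [CharP F p]
    [Algebra (ZMod p) F] (ζ : ℂ) (χ : MulChar F ℂ) : ℂ :=
  ∑ x : F, χ x * stdAddChar p ζ x

/-- Greene's normalized Jacobi sum `binom(A,B) = B(-1)/q · ∑ₓ A(x) B̄(1-x)`. -/
noncomputable def jacB {F : Type*} [Field F] [Fintype F] (A B : MulChar F ℂ) : ℂ :=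
  B (-1) / (Fintype.card F : ℂ) * ∑ x : F, A x * B⁻¹ (1 - x)

/-- Greene's finite field hypergeometric function `₂F₁(A, B; C | x)`. -/
noncomputable def greene2F1 {F : Type*} [Field F] [Fintype F]
    (A B C : MulChar F ℂ) (x : F) : ℂ :=
  (Fintype.card F : ℂ) / ((Fintype.card F : ℂ) - 1) *
    ∑ᶠ χ : MulChar F ℂ, jacB (A * χ) χ * jacB (B * χ) (C * χ) * χ x

/-- Greene's finite field hypergeometric function `₃F₂(A₀, A₁, A₂; B₁, B₂ | x)`. -/
noncomputable def greene3F2 {F : Type*} [Field F] [Fintype F]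
    (A₀ A₁ A₂ B₁ B₂ : MulChar F ℂ) (x : F) : ℂ :=
  (Fintype.card F : ℂ) / ((Fintype.card F : ℂ) - 1) *
    ∑ᶠ χ : MulChar F ℂ,
      jacB (A₀ * χ) χ * jacB (A₁ * χ) (B₁ * χ) * jacB (A₂ * χ) (B₂ * χ) * χ x

/-- The standard additive character of `F`, as a bundled `AddChar`. -/
noncomputable def stdAddCharHom {F : Type*} [Field F] [Fintype F] (p : ℕ) [Fact p.Prime]
    [CharP F p] [Algebra (ZMod p) F] {ζ : ℂ} (hζ : ζ ^ p = 1) : AddChar F ℂ :=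
  (AddChar.zmodChar p hζ).compAddMonoidHom (Algebra.trace (ZMod p) F).toAddMonoidHom

theorem gaussSum'_eq_gaussSum {F : Type*} [Field F] [Fintype F] (p : ℕ) [Fact p.Prime]
    [CharP F p] [Algebra (ZMod p) F] {ζ : ℂ} (hζ : ζ ^ p = 1) (χ : MulChar F ℂ) :
    gaussSum' p ζ χ = gaussSum χ (stdAddCharHom p hζ) :=
  rfl

theorem jacB_eq_jacobiSum {F : Type*} [Field F] [Fintype F] (A B : MulChar F ℂ) :
    jacB A B = B (-1) / (Fintype.card F : ℂ) * jacobiSum A B⁻¹ :=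
  rfl

theorem gaussSum_mul_jacB {F : Type*} [Field F] [Fintype F] {A B C : MulChar F ℂ}
    (hC : A * B⁻¹ = C) (hC1 : C ≠ 1) (ψ : AddChar F ℂ) :
    gaussSum C ψ * jacB A B =
      B (-1) / (Fintype.card F : ℂ) * (gaussSum A ψ * gaussSum B⁻¹ ψ) := by
  subst hC
  rw [jacB_eq_jacobiSum, ← jacobiSum_mul_nontrivial hC1 ψ]
  ring

theorem MulChar.apply_neg_one_mul_self {F : Type*} [Field F] (χ : MulChar F ℂ) :
    χ (-1) * χ (-1) = 1 := by
  rw [← map_mul, neg_one_mul, neg_neg, map_one]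

theorem sum_range_card_pow_eq_sum {G M : Type*} [Group G] [Fintype G] [AddCommMonoid M] {g : G}
    (hg : ∀ x, x ∈ Subgroup.zpowers g) (f : G → M) :
    ∑ j ∈ Finset.range (Fintype.card G), f (g ^ j) = ∑ x, f x := by
  classical
  have hcard : orderOf g = Fintype.card G := by
    rw [orderOf_eq_card_of_forall_mem_zpowers hg, Nat.card_eq_fintype_card]
  rw [← IsCyclic.image_range_card hg, Finset.sum_image, Nat.card_eq_fintype_card]
  rw [Nat.card_eq_fintype_card, ← hcard]
  intro i hi j hj hij
  exact pow_injOn_Iio_orderOf (by simpa using hi) (by simpa using hj) hij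

/-- A character `A` of order dividing four, with `A ^ 3 ≠ 1`, turns a product of Gauss sums into
the summand of the hypergeometric function `₂F₁(A ^ 3, A; A ^ 2 | ·)`. -/
theorem gaussSum_sq_mul_jacB_mul_jacB {F : Type*} [Field F] [Fintype F] {A : MulChar F ℂ}
    (hA4 : A ^ 4 = 1) (hA3 : A ^ 3 ≠ 1) (ψ : AddChar F ℂ) (χ : MulChar F ℂ) :
    (Fintype.card F : ℂ) ^ 2 * gaussSum (A ^ 3) ψ ^ 2 *
        (jacB (A ^ 3 * χ) χ * jacB (A * χ) (A ^ 2 * χ)) =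
      gaussSum (A * χ) ψ * gaussSum (A ^ 3 * χ) ψ * gaussSum χ⁻¹ ψ *
        gaussSum (A ^ 2 * χ)⁻¹ ψ := by
  have hq : (Fintype.card F : ℂ) ≠ 0 := Nat.cast_ne_zero.2 Fintype.card_ne_zero
  have hA : A * χ * (A ^ 2 * χ)⁻¹ = A ^ 3 := by
    rw [mul_inv_eq_iff_eq_mul, ← mul_assoc, ← pow_add, pow_succ A 4, hA4, one_mul]
  have h₁ := gaussSum_mul_jacB (mul_inv_cancel_right (A ^ 3) χ) hA3 ψ
  have h₂ := gaussSum_mul_jacB hA hA3 ψ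
  have hsign : χ (-1) * (A ^ 2 * χ) (-1) = 1 := by
    rw [MulChar.mul_apply, MulChar.pow_apply' _ two_ne_zero]
    linear_combination A (-1) ^ 2 * χ.apply_neg_one_mul_self + A.apply_neg_one_mul_self
  calc _ = (Fintype.card F : ℂ) ^ 2 * (gaussSum (A ^ 3) ψ * jacB (A ^ 3 * χ) χ) *
          (gaussSum (A ^ 3) ψ * jacB (A * χ) (A ^ 2 * χ)) := by ring
    _ = (χ (-1) * (A ^ 2 * χ) (-1)) * (gaussSum (A * χ) ψ * gaussSum (A ^ 3 * χ) ψ *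
          gaussSum χ⁻¹ ψ * gaussSum (A ^ 2 * χ)⁻¹ ψ) := by
      rw [h₁, h₂]
      field_simp
    _ = _ := by rw [hsign, one_mul]


/-- For `q ≡ 1 (mod 4)`, `t = (q-1)/4`, `T` a generator of the character group of `F_q^×`,
and `λ ∈ F_q` with `λ⁴ ∉ {0, 1}`:
`∑_{j=0}^{q-2} g(T^j)·g(T^{2t+j})·g(T^{t-j})·g(T^{3t-j})·T^{4j}(λ)
  = q(q-1)·g(T^{3t})²·₂F₁(T^{3t}, T^t; T^{2t} | λ⁴)`. -/
theorem gauss_sum_quadruple_eq_2F1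
    (F : Type*) [Field F] [Fintype F] (p : ℕ) [Fact p.Prime] [CharP F p] [Algebra (ZMod p) F]
    (ζ : ℂ) (hζ : IsPrimitiveRoot ζ p)
    (q t : ℕ) (hq : q = Fintype.card F) (hq4 : q % 4 = 1) (ht : t = (q - 1) / 4)
    (T : MulChar F ℂ) (hT : ∀ χ : MulChar F ℂ, χ ∈ Subgroup.zpowers T)
    (lam : F) (hlam0 : lam ^ 4 ≠ 0) (hlam1 : lam ^ 4 ≠ 1) :
    ∑ j ∈ Finset.range (q - 1),
        gaussSum' p ζ (T ^ j) * gaussSum' p ζ (T ^ (2 * t + j)) *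
          gaussSum' p ζ (T ^ ((t : ℤ) - (j : ℤ))) *
          gaussSum' p ζ (T ^ ((3 * t : ℤ) - (j : ℤ))) * (T ^ (4 * j)) lam =
      (q : ℂ) * ((q : ℂ) - 1) * gaussSum' p ζ (T ^ (3 * t)) ^ 2 *
        greene2F1 (T ^ (3 * t)) (T ^ t) (T ^ (2 * t)) (lam ^ 4) := by
  classical
  have := Fintype.ofFinite (MulChar F ℂ)
  set ψ := stdAddCharHom (F := F) p hζ.pow_eq_one with hψ
  simp only [gaussSum'_eq_gaussSum p hζ.pow_eq_one, ← hψ]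
  have hlam : IsUnit lam := isUnit_iff_ne_zero.2 fun h => hlam0 (by simp [h])
  have hcard : Fintype.card (MulChar F ℂ) = q - 1 := by
    rw [← Nat.card_eq_fintype_card, MulChar.card_eq_card_units_of_hasEnoughRootsOfUnity,
      Nat.card_eq_fintype_card, Fintype.card_units, hq]
  have horder : orderOf T = 4 * t := by
    rw [orderOf_eq_card_of_forall_mem_zpowers hT, Nat.card_eq_fintype_card, hcard]
    omega
  have hq1 : 1 < q := hq ▸ Fintype.one_lt_card
  have hT4 : T ^ (4 * t) = 1 := horder ▸ pow_orderOf_eq_one T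
  obtain ⟨A, hA⟩ : ∃ A, A = T ^ t := ⟨_, rfl⟩
  have hA2 : T ^ (2 * t) = A ^ 2 := by rw [hA, ← pow_mul, mul_comm]
  have hA3 : T ^ (3 * t) = A ^ 3 := by rw [hA, ← pow_mul, mul_comm]
  have hA4 : A ^ 4 = 1 := by rw [hA, ← pow_mul, mul_comm, hT4]
  have hA3ne : A ^ 3 ≠ 1 := by
    rw [← hA3]
    exact pow_ne_one_of_lt_orderOf (by omega) (by omega)
  have hA2inv : (A ^ 2)⁻¹ = A ^ 2 := inv_eq_of_mul_eq_one_left (by rw [← pow_add, hA4])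
  have hq0 : (q : ℂ) ≠ 0 := Nat.cast_ne_zero.2 (by omega)
  have hq1' : (q : ℂ) - 1 ≠ 0 := sub_ne_zero.2 (by exact_mod_cast hq1.ne')
  let f : MulChar F ℂ → ℂ := fun χ => gaussSum χ ψ * gaussSum (A ^ 2 * χ) ψ *
    gaussSum (A * χ⁻¹) ψ * gaussSum (A ^ 3 * χ⁻¹) ψ * (χ ^ 4) lam
  calc _ = ∑ j ∈ Finset.range (Fintype.card (MulChar F ℂ)), f (T ^ j) := by
        rw [hcard]
        refine Finset.sum_congr rfl fun j _ => ?_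
        have h3 : T ^ ((3 * t : ℤ) - (j : ℤ)) = A ^ 3 * (T ^ j)⁻¹ := by
          rw [zpow_sub, ← hA3, ← zpow_natCast T (3 * t), zpow_natCast T j]
          push_cast
          rfl
        rw [h3, zpow_sub, zpow_natCast, zpow_natCast, pow_add, hA2, ← hA, mul_comm 4 j, pow_mul]
    _ = ∑ χ, f χ := sum_range_card_pow_eq_sum hT f
    _ = ∑ χ, f (A * χ) := (Equiv.sum_comp (Equiv.mulLeft A) f).symm
    _ = ∑ χ : MulChar F ℂ, (q : ℂ) ^ 2 * gaussSum (A ^ 3) ψ ^ 2 *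
          (jacB (A ^ 3 * χ) χ * jacB (A * χ) (A ^ 2 * χ) * χ (lam ^ 4)) := by
        refine Finset.sum_congr rfl fun χ _ => ?_
        have key := gaussSum_sq_mul_jacB_mul_jacB hA4 hA3ne ψ χ
        rw [← hq] at key
        have e1 : A ^ 2 * (A * χ) = A ^ 3 * χ := by rw [← mul_assoc, ← pow_succ]
        have e2 : A * (A * χ)⁻¹ = χ⁻¹ := by rw [mul_inv, mul_inv_cancel_left]
        have e3 : A ^ 3 * (A * χ)⁻¹ = (A ^ 2 * χ)⁻¹ := by
          rw [mul_inv, mul_inv, hA2inv, pow_succ A 2, mul_assoc, mul_inv_cancel_left]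
        have e4 : ((A * χ) ^ 4) lam = χ (lam ^ 4) := by
          rw [mul_pow, hA4, one_mul, MulChar.pow_apply' _ four_ne_zero, map_pow]
        simp only [f, e1, e2, e3, e4]
        rw [← mul_assoc, key]
    _ = _ := by
        rw [greene2F1, finsum_eq_sum_of_fintype, ← Finset.mul_sum, hA2, hA3, ← hA, ← hq]
        field_simp
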